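/- For almost every x ∈ (0,1), limsup_{n→∞} (−log θ_n(x))/(log n) = 1, where θ_n(x) = q_n·|q_n x − p_n| are the approximation constants of x (the classical case of Theorem 4). -/

import Mathlib

open Filter MeasureTheory Real Topology

/-- The Gauss map `x ↦ {1/x}`. -/
noncomputable def gaussMap (x : ℝ) : ℝ := Int.fract x⁻¹

/-- `partQuot x n` is the `n`-th partial quotient `aₙ` of the regular continued fraction
expansion `x = [a₁, a₂, …]` of `x ∈ (0,1)` (meaningful for `n ≥ 1`). -/
noncomputable def partQuot (x : ℝ) (n : ℕ) : ℕ := (⌊(gaussMap^[n - 1] x)⁻¹⌋).toNat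

/-- `cfQ x n` is the denominator `qₙ` of the `n`-th continued fraction convergent
`pₙ/qₙ = [a₁, …, aₙ]` of `x`, given by `q₀ = 1`, `q₁ = a₁`, `qₙ = aₙ qₙ₋₁ + qₙ₋₂`. -/
noncomputable def cfQ (x : ℝ) : ℕ → ℤ
  | 0 => 1
  | 1 => partQuot x 1
  | (n + 2) => partQuot x (n + 2) * cfQ x (n + 1) + cfQ x n

/-- `cfP x n` is the numerator `pₙ` of the `n`-th continued fraction convergent of `x`,
given by `p₀ = 0`, `p₁ = 1`, `pₙ = aₙ pₙ₋₁ + pₙ₋₂`. -/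
noncomputable def cfP (x : ℝ) : ℕ → ℤ
  | 0 => 0
  | 1 => 1
  | (n + 2) => partQuot x (n + 2) * cfP x (n + 1) + cfP x n


/-- The approximation constants `θₙ(x) = qₙ·|qₙ x − pₙ|`. -/
noncomputable def theta (x : ℝ) (n : ℕ) : ℝ :=
  (cfQ x n : ℝ) * |(cfQ x n : ℝ) * x - (cfP x n : ℝ)|

/-- The irrationals in the unit interval. -/
def irrUnit : Set ℝ := {x | x ∈ Set.Ioo (0 : ℝ) 1 ∧ Irrational x}

lemma gaussMap_mem {x : ℝ} (hx : x ∈ irrUnit) : gaussMap x ∈ irrUnit := by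
  obtain ⟨-, hi⟩ := hx
  have h : Irrational (gaussMap x) := by
    unfold gaussMap Int.fract
    exact hi.inv.sub_intCast _
  refine ⟨⟨?_, Int.fract_lt_one _⟩, h⟩
  exact lt_of_le_of_ne (Int.fract_nonneg _) (fun h0 => h.ne_zero h0.symm)

lemma iter_mem {x : ℝ} (hx : x ∈ irrUnit) (n : ℕ) : gaussMap^[n] x ∈ irrUnit := by
  induction n with
  | zero => exact hx
  | succ n ih => rw [Function.iterate_succ_apply']; exact gaussMap_mem ih

lemma one_le_floor {x : ℝ} (hx : x ∈ irrUnit) : 1 ≤ ⌊x⁻¹⌋ := by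
  rw [Int.le_floor]
  push_cast
  exact (one_le_inv₀ hx.1.1).2 hx.1.2.le

lemma partQuot_add {x : ℝ} (hx : x ∈ irrUnit) (n : ℕ) :
    1 ≤ partQuot x (n + 1) ∧
    (partQuot x (n + 1) : ℝ) + gaussMap^[n + 1] x = (gaussMap^[n] x)⁻¹ := by
  have h1 := one_le_floor (iter_mem hx n)
  have h2 : ((partQuot x (n + 1) : ℤ)) = ⌊(gaussMap^[n] x)⁻¹⌋ := by
    unfold partQuot
    rw [Int.toNat_of_nonneg] <;> simp <;> linarith
  refine ⟨by omega, ?_⟩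
  have h3 : ((partQuot x (n + 1) : ℝ)) = (⌊(gaussMap^[n] x)⁻¹⌋ : ℝ) := by
    rw [← h2]; simp
  rw [h3, Function.iterate_succ_apply']
  exact Int.floor_add_fract _

lemma cfQ_pos {x : ℝ} (hx : x ∈ irrUnit) (n : ℕ) : 1 ≤ cfQ x n ∧ cfQ x n ≤ cfQ x (n + 1) := by
  induction n with
  | zero =>
    have := (partQuot_add hx 0).1
    simp only [cfQ, zero_add] at *
    omega
  | succ n ih =>
    have h := (partQuot_add hx (n + 1)).1
    obtain ⟨h1, h2⟩ := ih
    refine ⟨by linarith, ?_⟩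
    have h' : (1 : ℤ) ≤ (partQuot x (n + 1 + 1) : ℤ) := by exact_mod_cast h
    simp only [cfQ]
    nlinarith

lemma cf_D {x : ℝ} (hx : x ∈ irrUnit) (n : ℕ) :
    ((cfQ x (n + 1) : ℝ) * x - cfP x (n + 1) = - gaussMap^[n + 1] x * (cfQ x n * x - cfP x n)) ∧
    |(cfQ x n : ℝ) * x - cfP x n| * (cfQ x (n + 1) + gaussMap^[n + 1] x * cfQ x n) = 1 := by
  induction n with
  | zero =>
    have h := (partQuot_add hx 0).2
    have h0 := hx.1.1
    simp only [cfQ, cfP, zero_add, Function.iterate_zero, id] at *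
    have h' : gaussMap^[1] x = x⁻¹ - partQuot x 1 := by linarith
    rw [h']
    push_cast
    constructor
    · field_simp; ring
    · rw [abs_of_pos (by simpa using h0)]; field_simp; ring
  | succ n ih =>
    obtain ⟨h1, h2⟩ := ih
    have h := (partQuot_add hx (n + 1)).2
    have ht := (iter_mem hx (n + 1)).1.1
    have h' : gaussMap^[n + 1 + 1] x = (gaussMap^[n + 1] x)⁻¹ - partQuot x (n + 1 + 1) := by linarith
    rw [h1, h']
    simp only [cfQ, cfP]
    generalize gaussMap^[n + 1] x = t at *
    push_cast
    constructor
    · have e : ((partQuot x (n + 1 + 1) : ℝ) * cfQ x (n + 1) + cfQ x n) * x -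
        (partQuot x (n + 1 + 1) * cfP x (n + 1) + cfP x n) =
        partQuot x (n + 1 + 1) * (cfQ x (n + 1) * x - cfP x (n + 1)) + (cfQ x n * x - cfP x n) := by
        ring
      rw [e, h1]
      field_simp
      ring
    · rw [abs_mul, abs_neg, abs_of_pos ht]
      refine Eq.trans ?_ h2
      field_simp
      ring

lemma theta_bounds {x : ℝ} (hx : x ∈ irrUnit) (n : ℕ) :
    gaussMap^[n + 1] x / 2 ≤ theta x (n + 1) ∧ theta x (n + 1) ≤ gaussMap^[n + 1] x := by
  obtain ⟨h1, h2⟩ := cf_D hx n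
  obtain ⟨⟨ht0, ht1⟩, -⟩ := iter_mem hx (n + 1)
  obtain ⟨hq1, hq2⟩ := cfQ_pos hx n
  have hq1' : (1 : ℝ) ≤ cfQ x n := by exact_mod_cast hq1
  have hq2' : (cfQ x n : ℝ) ≤ cfQ x (n + 1) := by exact_mod_cast hq2
  unfold theta
  rw [h1, abs_mul, abs_neg, abs_of_pos ht0]
  have hd := abs_nonneg ((cfQ x n : ℝ) * x - cfP x n)
  generalize |(cfQ x n : ℝ) * x - cfP x n| = d at *
  generalize gaussMap^[n + 1] x = t at *
  have a1 : d * cfQ x (n + 1) ≤ 1 := by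
    have : 0 ≤ d * (t * cfQ x n) := by positivity
    nlinarith
  have a2 : 1 ≤ 2 * (d * cfQ x (n + 1)) := by
    have : d * (t * cfQ x n) ≤ d * cfQ x (n + 1) := by
      apply mul_le_mul_of_nonneg_left _ hd
      nlinarith
    nlinarith
  constructor <;> nlinarith

lemma measurable_gaussMap : Measurable gaussMap := by
  unfold gaussMap
  exact measurable_fract.comp measurable_inv

lemma countable_rat : (Set.range ((↑) : ℚ → ℝ)).Countable := Set.countable_range _

lemma measurableSet_irrUnit : MeasurableSet irrUnit :=
  measurableSet_Ioo.inter countable_rat.measurableSet.compl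

/-- The conditional laws. -/
noncomputable def mu (s : ℝ) : Measure ℝ :=
  (volume.restrict irrUnit).withDensity (fun x => ENNReal.ofReal ((1 + s) / (1 + s * x) ^ 2))

lemma mu_apply (s : ℝ) {A : Set ℝ} (hA : MeasurableSet A) :
    mu s A = ∫⁻ x in A ∩ irrUnit, ENNReal.ofReal ((1 + s) / (1 + s * x) ^ 2) := by
  rw [mu, withDensity_apply _ hA, Measure.restrict_restrict hA]

lemma mu_zero : mu 0 = volume.restrict irrUnit := by
  simp [mu]

lemma mu_compl (s : ℝ) : mu s irrUnitᶜ = 0 := by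
  rw [mu_apply _ measurableSet_irrUnit.compl]; simp

/-- The branch of the Gauss map with digit `a`. -/
def cyl (a : ℕ) : Set ℝ := {x | ⌊x⁻¹⌋ = (a : ℤ)}

lemma measurableSet_cyl (a : ℕ) : MeasurableSet (cyl a) :=
  (Int.measurable_floor.comp measurable_inv) (measurableSet_singleton (a : ℤ))

lemma image_branch {a : ℕ} (ha : 1 ≤ a) (A : Set ℝ) :
    (cyl a ∩ gaussMap ⁻¹' A) ∩ irrUnit = (fun y : ℝ => ((a : ℝ) + y)⁻¹) '' (A ∩ irrUnit) := by
  have ha' : (1 : ℝ) ≤ a := by exact_mod_cast ha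
  ext x
  constructor
  · rintro ⟨⟨h1, h2⟩, h3⟩
    refine ⟨gaussMap x, ⟨h2, gaussMap_mem h3⟩, ?_⟩
    have h1' : ⌊x⁻¹⌋ = (a : ℤ) := h1
    have : (a : ℝ) + gaussMap x = x⁻¹ := by
      have := Int.floor_add_fract x⁻¹
      rw [h1'] at this
      simpa [gaussMap] using this
    simp only [this, inv_inv]
  · rintro ⟨y, ⟨hyA, ⟨hy0, hy1⟩, hi⟩, rfl⟩
    have hf : ⌊(a : ℝ) + y⌋ = (a : ℤ) := by
      rw [Int.floor_eq_iff]; push_cast; constructor <;> linarith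
    refine ⟨⟨?_, ?_⟩, ⟨⟨by positivity, ?_⟩, ?_⟩⟩
    · simpa [cyl] using hf
    · have : gaussMap ((a : ℝ) + y)⁻¹ = y := by
        unfold gaussMap Int.fract
        rw [inv_inv, hf]; simp
      simpa [this] using hyA
    · exact inv_lt_one_of_one_lt₀ (by linarith)
    · exact (hi.natCast_add a).inv

lemma mu_cyl {s : ℝ} (hs : s ∈ Set.Icc (0 : ℝ) 1) {a : ℕ} (ha : 1 ≤ a) {A : Set ℝ}
    (hA : MeasurableSet A) :
    mu s (cyl a ∩ gaussMap ⁻¹' A) =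
      ENNReal.ofReal ((1 + s) / (a + s) - (1 + s) / (a + 1 + s)) * mu (1 / (a + s)) A := by
  have ha' : (1 : ℝ) ≤ a := by exact_mod_cast ha
  have hs0 := hs.1
  have hw : 0 ≤ (1 + s) / (a + s) - (1 + s) / (a + 1 + s) := by
    rw [sub_nonneg]; gcongr; linarith
  rw [mu_apply _ ((measurableSet_cyl a).inter (measurable_gaussMap hA)), image_branch ha,
    mu_apply _ hA, ← lintegral_const_mul _ (by fun_prop)]
  rw [lintegral_image_eq_lintegral_abs_deriv_mul (f' := fun y => -1 / ((a : ℝ) + y) ^ 2)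
    (hA.inter measurableSet_irrUnit)]
  · apply setLIntegral_congr_fun (hA.inter measurableSet_irrUnit)
    rintro y ⟨-, ⟨hy0, hy1⟩, -⟩
    simp only
    rw [← ENNReal.ofReal_mul (abs_nonneg _), ← ENNReal.ofReal_mul hw, abs_div, abs_neg, abs_one,
      abs_of_nonneg (by positivity)]
    congr 1
    have h1 : (a : ℝ) + y ≠ 0 := by positivity
    have h2 : (a : ℝ) + s ≠ 0 := by positivity
    have h3 : (a : ℝ) + 1 + s ≠ 0 := by positivity
    have h4 : (a : ℝ) + y + s ≠ 0 := by positivity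
    have e1 : 1 + s * ((a : ℝ) + y)⁻¹ = (a + y + s) / (a + y) := by field_simp
    have e2 : 1 + 1 / ((a : ℝ) + s) * y = (a + y + s) / (a + s) := by field_simp; ring
    have e3 : 1 + 1 / ((a : ℝ) + s) = (a + 1 + s) / (a + s) := by field_simp; ring
    rw [e1, e2, e3]
    field_simp
    ring
  · rintro y ⟨-, ⟨hy0, hy1⟩, -⟩
    have h1 : (a : ℝ) + y ≠ 0 := by positivity
    exact (((hasDerivAt_id y).const_add (a : ℝ)).inv h1).hasDerivWithinAt
  · intro y _ z _ h
    simpa using h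

lemma param_mem {s : ℝ} (hs : s ∈ Set.Icc (0 : ℝ) 1) {a : ℕ} (ha : 1 ≤ a) :
    1 / ((a : ℝ) + s) ∈ Set.Icc (0 : ℝ) 1 := by
  have ha' : (1 : ℝ) ≤ a := by exact_mod_cast ha
  have hs0 := hs.1
  refine ⟨by positivity, ?_⟩
  rw [div_le_one (by linarith)]; linarith

lemma sum_weights {s : ℝ} (hs : s ∈ Set.Icc (0 : ℝ) 1) (n : ℕ) (C : ENNReal) :
    ∑ i ∈ Finset.range n,
      ENNReal.ofReal ((1 + s) / ((i + 1 : ℕ) + s) - (1 + s) / ((i + 1 : ℕ) + 1 + s)) * C ≤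
    ENNReal.ofReal (1 - 1 / (n + 1)) * C := by
  have hs0 := hs.1
  rw [← Finset.sum_mul, ← ENNReal.ofReal_sum_of_nonneg]
  · gcongr
    have := Finset.sum_range_sub' (fun i : ℕ => (1 + s) / ((i : ℝ) + 1 + s)) n
    push_cast at *
    rw [this]
    have h2 : (1 + s) / (0 + 1 + s) = 1 := by rw [zero_add]; exact div_self (by linarith)
    rw [h2]
    gcongr ?_ - ?_
    rw [div_le_div_iff₀ (by positivity) (by positivity)]
    have : 0 ≤ s * n := by positivity
    nlinarith
  · intro i _
    rw [sub_nonneg]; gcongr; linarith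

lemma mu_step {A : Set ℝ} (hA : MeasurableSet A) {C : ENNReal}
    (hC : ∀ s ∈ Set.Icc (0 : ℝ) 1, mu s A ≤ C) {s : ℝ} (hs : s ∈ Set.Icc (0 : ℝ) 1) (n : ℕ) :
    mu s ({x | ⌊x⁻¹⌋ < (n : ℤ) + 1} ∩ gaussMap ⁻¹' A) ≤ ENNReal.ofReal (1 - 1 / (n + 1)) * C := by
  refine le_trans ?_ (sum_weights hs n C)
  have hsub : {x : ℝ | ⌊x⁻¹⌋ < (n : ℤ) + 1} ∩ gaussMap ⁻¹' A ⊆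
      irrUnitᶜ ∪ ⋃ i ∈ Finset.range n, (cyl (i + 1) ∩ gaussMap ⁻¹' A) := by
    rintro x ⟨h1, h2⟩
    by_cases hx : x ∈ irrUnit
    · right
      have h3 := one_le_floor hx
      have h1' : ⌊x⁻¹⌋ < (n : ℤ) + 1 := h1
      simp only [Set.mem_iUnion, Finset.mem_range]
      refine ⟨(⌊x⁻¹⌋ - 1).toNat, by omega, ?_, h2⟩
      change ⌊x⁻¹⌋ = _
      omega
    · left; exact hx
  refine (measure_mono hsub).trans ((measure_union_le _ _).trans ?_)
  rw [mu_compl, zero_add]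
  refine (measure_biUnion_finset_le _ _).trans ?_
  refine Finset.sum_le_sum fun i _ => ?_
  rw [mu_cyl hs (by omega) hA]
  gcongr
  exact hC _ (param_mem hs (by omega))

lemma mu_step' {A : Set ℝ} (hA : MeasurableSet A) {C : ENNReal}
    (hC : ∀ s ∈ Set.Icc (0 : ℝ) 1, mu s A ≤ C) {s : ℝ} (hs : s ∈ Set.Icc (0 : ℝ) 1) :
    mu s (gaussMap ⁻¹' A) ≤ C := by
  have : gaussMap ⁻¹' A = ⋃ n : ℕ, ({x | ⌊x⁻¹⌋ < (n : ℤ) + 1} ∩ gaussMap ⁻¹' A) := by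
    ext x
    simp only [Set.mem_iUnion, Set.mem_inter_iff, Set.mem_ofPred_eq]
    constructor
    · intro h
      exact ⟨⌊x⁻¹⌋.toNat, by omega, h⟩
    · rintro ⟨_, _, h⟩; exact h
  rw [this, Monotone.measure_iUnion]
  · refine iSup_le fun n => (mu_step hA hC hs n).trans ?_
    refine mul_le_of_le_one_left' ?_
    rw [← ENNReal.ofReal_one]
    apply ENNReal.ofReal_le_ofReal
    have : (0 : ℝ) ≤ 1 / (n + 1) := by positivity
    linarith
  · intro n m h x hx
    refine ⟨?_, hx.2⟩
    have h1 : ⌊x⁻¹⌋ < (n : ℤ) + 1 := hx.1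
    change ⌊x⁻¹⌋ < (m : ℤ) + 1
    omega

lemma mu_iter {A : Set ℝ} (hA : MeasurableSet A) {C : ENNReal}
    (hC : ∀ s ∈ Set.Icc (0 : ℝ) 1, mu s A ≤ C) (n : ℕ) :
    ∀ s ∈ Set.Icc (0 : ℝ) 1, mu s (gaussMap^[n] ⁻¹' A) ≤ C := by
  induction n with
  | zero => simpa using hC
  | succ n ih =>
    intro s hs
    rw [Function.iterate_succ, Set.preimage_comp]
    exact mu_step' ((measurable_gaussMap.iterate n) hA) ih hs

lemma mu_Iio {s : ℝ} (hs : s ∈ Set.Icc (0 : ℝ) 1) (d : ℝ) :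
    mu s (Set.Iio d) ≤ ENNReal.ofReal (2 * d) := by
  rw [mu_apply _ measurableSet_Iio]
  calc _ ≤ ∫⁻ x in Set.Iio d ∩ irrUnit, ENNReal.ofReal 2 := by
        apply setLIntegral_mono' (measurableSet_Iio.inter measurableSet_irrUnit)
        rintro x ⟨-, ⟨hx0, hx1⟩, -⟩
        apply ENNReal.ofReal_le_ofReal
        have hs0 := hs.1
        have hs1 := hs.2
        have : 0 ≤ s * x := by positivity
        rw [div_le_iff₀ (by positivity)]
        nlinarith
    _ = ENNReal.ofReal 2 * volume (Set.Iio d ∩ irrUnit) := by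
        rw [setLIntegral_const]
    _ ≤ ENNReal.ofReal 2 * volume (Set.Ioo 0 d) := by
        gcongr
        rintro x ⟨h, ⟨hx0, hx1⟩, -⟩
        exact ⟨hx0, h⟩
    _ = _ := by
        rw [Real.volume_Ioo, sub_zero, ← ENNReal.ofReal_mul (by norm_num)]

/-- Points whose first `n` digits stay small. -/
def smallDigits (N n : ℕ) : Set ℝ := {x | ∀ k < n, ⌊(gaussMap^[k] x)⁻¹⌋ < (k : ℤ) + N + 2}

lemma smallDigits_succ (N n : ℕ) : smallDigits N (n + 1) =
    {x | ⌊x⁻¹⌋ < ((N + 1 : ℕ) : ℤ) + 1} ∩ gaussMap ⁻¹' smallDigits (N + 1) n := by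
  ext x
  simp only [smallDigits, Set.mem_ofPred_eq, Set.mem_inter_iff, Set.mem_preimage]
  constructor
  · intro h
    refine ⟨?_, fun k hk => ?_⟩
    · have := h 0 (by omega)
      simp only [Function.iterate_zero, id] at this
      push_cast at *
      omega
    · have := h (k + 1) (by omega)
      rw [Function.iterate_succ_apply] at this
      push_cast at *
      omega
  · rintro ⟨h1, h2⟩ k hk
    cases k with
    | zero => simp only [Function.iterate_zero, id]; push_cast at *; omega
    | succ k =>
      have := h2 k (by omega)
      rw [Function.iterate_succ_apply]
      push_cast at *
      omega

lemma measurableSet_smallDigits (N n : ℕ) : MeasurableSet (smallDigits N n) := by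
  induction n generalizing N with
  | zero => simp [smallDigits]
  | succ n ih =>
    rw [smallDigits_succ]
    exact ((Int.measurable_floor.comp measurable_inv) measurableSet_Iio).inter
      (measurable_gaussMap (ih _))

lemma mu_univ_le {s : ℝ} (hs : s ∈ Set.Icc (0 : ℝ) 1) : mu s Set.univ ≤ 2 := by
  have hsub : (Set.univ : Set ℝ) ⊆ irrUnitᶜ ∪ Set.Iio 1 := by
    intro x _
    by_cases hx : x ∈ irrUnit
    · right; exact hx.1.2
    · left; exact hx
  refine (measure_mono hsub).trans ((measure_union_le _ _).trans ?_)
  rw [mu_compl, zero_add]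
  simpa using mu_Iio hs 1

lemma mu_smallDigits (n : ℕ) : ∀ N : ℕ, ∀ s ∈ Set.Icc (0 : ℝ) 1,
    mu s (smallDigits N n) ≤ ENNReal.ofReal (((N : ℝ) + 1) / (N + n + 1)) * 2 := by
  induction n with
  | zero =>
    intro N s hs
    refine (measure_mono (Set.subset_univ _)).trans ((mu_univ_le hs).trans ?_)
    have : ((N : ℝ) + 1) / (N + (0 : ℕ) + 1) = 1 := by
      push_cast; rw [add_zero]; exact div_self (by positivity)
    rw [this]; simp
  | succ n ih =>
    intro N s hs
    rw [smallDigits_succ]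
    refine (mu_step (measurableSet_smallDigits _ _) (ih (N + 1)) hs (N + 1)).trans ?_
    have h0 : (0 : ℝ) ≤ 1 - 1 / ((N + 1 : ℕ) + 1) := by
      rw [sub_nonneg, div_le_one (by positivity)]; push_cast
      have : (0 : ℝ) ≤ N := by positivity
      linarith
    rw [← mul_assoc, ← ENNReal.ofReal_mul h0]
    gcongr
    apply le_of_eq
    push_cast
    field_simp
    ring

lemma mu_small_null (N : ℕ) : ∀ s ∈ Set.Icc (0 : ℝ) 1, mu s (⋂ n, smallDigits N n) ≤ 0 := by
  intro s hs
  have hlim : Tendsto (fun n : ℕ => ENNReal.ofReal (((N : ℝ) + 1) / (N + n + 1)) * 2) atTop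
      (𝓝 (ENNReal.ofReal 0 * 2)) := by
    apply ENNReal.Tendsto.mul_const _ (Or.inr (by norm_num))
    apply ENNReal.tendsto_ofReal
    apply Tendsto.const_div_atTop
    apply tendsto_atTop_add_const_right
    apply tendsto_atTop_add_const_left
    exact tendsto_natCast_atTop_atTop
  simp only [ENNReal.ofReal_zero, zero_mul] at hlim
  exact ge_of_tendsto' hlim fun n =>
    (measure_mono (Set.iInter_subset _ n)).trans (mu_smallDigits n N s hs)

lemma ae_frequently : ∀ᵐ x ∂(mu 0), ∃ᶠ n : ℕ in atTop, (n : ℤ) + 2 ≤ ⌊(gaussMap^[n] x)⁻¹⌋ := by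
  have h : ∀ N : ℕ, ∀ᵐ x ∂(mu 0), x ∉ gaussMap^[N] ⁻¹' (⋂ n, smallDigits N n) := by
    intro N
    rw [← measure_eq_zero_iff_ae_notMem]
    exact nonpos_iff_eq_zero.1 (mu_iter (MeasurableSet.iInter fun n => measurableSet_smallDigits N n)
      (mu_small_null N) N 0 (by simp))
  filter_upwards [ae_all_iff.2 h] with x hx
  rw [frequently_atTop]
  intro N
  have := hx N
  simp only [smallDigits, Set.mem_preimage, Set.mem_iInter, Set.mem_ofPred_eq] at this
  push Not at this
  obtain ⟨_, k, _, hk⟩ := this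
  refine ⟨k + N, by omega, ?_⟩
  rw [Function.iterate_add_apply]
  push_cast
  omega

lemma ae_eventually {p : ℝ} (hp : 1 < p) :
    ∀ᵐ x ∂(mu 0), ∀ᶠ n : ℕ in atTop, 1 / (n : ℝ) ^ p ≤ gaussMap^[n] x := by
  have h : ∑' n : ℕ, mu 0 (gaussMap^[n] ⁻¹' (Set.Iio (1 / (n : ℝ) ^ p))) ≠ ⊤ := by
    refine ne_top_of_le_ne_top
      ((Real.summable_one_div_nat_rpow.2 hp).mul_left 2).tsum_ofReal_ne_top ?_
    exact ENNReal.tsum_le_tsum fun n =>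
      mu_iter measurableSet_Iio (fun s hs => mu_Iio hs _) n 0 (by simp)
  filter_upwards [ae_eventually_notMem h] with x hx
  filter_upwards [hx] with n hn
  simpa using hn

lemma limsup_aux {x : ℝ} (hx : x ∈ irrUnit)
    (h1 : ∃ᶠ n : ℕ in atTop, (n : ℤ) + 2 ≤ ⌊(gaussMap^[n] x)⁻¹⌋)
    (h2 : ∀ k : ℕ, ∀ᶠ n : ℕ in atTop, 1 / (n : ℝ) ^ (1 + 1 / ((k : ℝ) + 1)) ≤ gaussMap^[n] x) :
    Filter.limsup (fun n : ℕ => -Real.log (theta x n) / Real.log n) atTop = 1 := by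
  have hth : ∀ n : ℕ, 2 ≤ n → 0 < gaussMap^[n] x ∧ gaussMap^[n] x / 2 ≤ theta x n ∧
      theta x n ≤ gaussMap^[n] x := by
    intro n hn
    obtain ⟨m, rfl⟩ : ∃ m, n = m + 1 := ⟨n - 1, by omega⟩
    exact ⟨(iter_mem hx _).1.1, theta_bounds hx m⟩
  have hlow : ∃ᶠ n : ℕ in atTop, (1 : ℝ) ≤ -Real.log (theta x n) / Real.log n := by
    refine (h1.and_eventually (eventually_ge_atTop 2)).mono ?_
    rintro n ⟨hn, hn2⟩
    obtain ⟨ht, hl, hu⟩ := hth n hn2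
    have hn2' : (2 : ℝ) ≤ n := by exact_mod_cast hn2
    have hlog : 0 < Real.log n := Real.log_pos (by linarith)
    rw [le_div_iff₀ hlog, one_mul, ← Real.log_inv]
    apply Real.log_le_log (by linarith)
    have h3 := Int.le_floor.1 hn
    push_cast at h3
    have h4 : (gaussMap^[n] x)⁻¹ ≤ (theta x n)⁻¹ := inv_anti₀ (by linarith) hu
    linarith
  have hup : ∀ e : ℝ, 0 < e →
      ∀ᶠ n : ℕ in atTop, -Real.log (theta x n) / Real.log n ≤ 1 + e := by
    intro e he
    obtain ⟨k, hk⟩ := exists_nat_one_div_lt (half_pos he)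
    have hL : ∀ᶠ n : ℕ in atTop, Real.log 2 / (e / 2) ≤ Real.log n :=
      (Real.tendsto_log_atTop.comp tendsto_natCast_atTop_atTop).eventually_ge_atTop _
    filter_upwards [h2 k, hL, eventually_ge_atTop 2] with n hn hLn hn2
    obtain ⟨ht, hl, hu⟩ := hth n hn2
    have hn2' : (2 : ℝ) ≤ n := by exact_mod_cast hn2
    have hlog : 0 < Real.log n := Real.log_pos (by linarith)
    have hpow : 0 < (n : ℝ) ^ (1 + 1 / ((k : ℝ) + 1)) := Real.rpow_pos_of_pos (by linarith) _
    rw [div_le_iff₀ hlog]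
    rw [div_le_iff₀ (by positivity)] at hLn
    have a1 : Real.log (gaussMap^[n] x / 2) ≤ Real.log (theta x n) :=
      Real.log_le_log (by linarith) hl
    rw [Real.log_div ht.ne' (by norm_num)] at a1
    have a2 := Real.log_le_log (by positivity) hn
    rw [one_div, Real.log_inv, Real.log_rpow (by linarith)] at a2
    nlinarith
  apply le_antisymm
  · refine le_of_forall_pos_le_add fun e he => ?_
    exact limsup_le_of_le (IsCoboundedUnder.of_frequently_ge hlow) (hup e he)
  · exact le_limsup_of_frequently_le hlow ⟨1 + 1, by simpa using hup 1 one_pos⟩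

/-- For almost every `x ∈ (0,1)`,
`limsup_{n→∞} (−log θₙ(x))/(log n) = 1`, where `θₙ(x) = qₙ·|qₙ x − pₙ|`. -/
theorem limsup_neg_log_theta :
    ∀ᵐ x ∂(volume.restrict (Set.Ioo (0 : ℝ) 1)),
      Filter.limsup (fun n : ℕ => -Real.log (theta x n) / Real.log n) atTop = 1 := by
  have hirr : ∀ᵐ x ∂(volume : Measure ℝ), x ∉ Set.range ((↑) : ℚ → ℝ) :=
    countable_rat.ae_notMem volume
  have hmain : ∀ᵐ x ∂(volume.restrict irrUnit),
      Filter.limsup (fun n : ℕ => -Real.log (theta x n) / Real.log n) atTop = 1 := by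
    have h2 : ∀ᵐ x ∂(mu 0), ∀ k : ℕ, ∀ᶠ n : ℕ in atTop,
        1 / (n : ℝ) ^ (1 + 1 / ((k : ℝ) + 1)) ≤ gaussMap^[n] x :=
      ae_all_iff.2 fun k => ae_eventually (by
        have : (0 : ℝ) < 1 / ((k : ℝ) + 1) := by positivity
        linarith)
    have h1 := ae_frequently
    rw [mu_zero] at h1 h2
    filter_upwards [h1, h2, ae_restrict_mem measurableSet_irrUnit] with x a b c
    exact limsup_aux c a b
  rw [ae_restrict_iff' measurableSet_irrUnit] at hmain
  rw [ae_restrict_iff' measurableSet_Ioo]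
  filter_upwards [hirr, hmain] with x h1 h2 h3
  exact h2 ⟨h3, h1⟩
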